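/- arXiv:1406.3076 — 11 statements merged into one kernel-verified Lean document; each statement's English description precedes it below -/
import Mathlib

section
/- Let s : X → L.Term Y be a substitution, x ∈ X and y ∈ Y such that s x = Term.var y and y does not occur among the variables of the term s x' for every x' ≠ x. Then for every subset A ⊆ (X → H), s_*(∃x A) = ∃y (s_* A). (Proposition 2.9: the algebras Hal_Θ(H) satisfy the Halmos-algebra identity (3b) relating substitution operations with quantifiers.) -/
open FirstOrder FirstOrder.Language

/-- The value of a term depends only on the values of the variables occurring in it. -/
theorem FirstOrder.Language.Term.realize_congr_of_eqOn_varFinset {L : Language} {M α : Type*}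
    [L.Structure M] [DecidableEq α] {t : L.Term α} {v w : α → M}
    (h : ∀ a ∈ t.varFinset, v a = w a) : t.realize v = t.realize w := by
  induction t with
  | var a => exact h a (by simp [Term.varFinset])
  | func f ts ih =>
    simp only [Term.realize_func]
    congr 1
    funext i
    exact ih i fun a ha => h a (Finset.mem_biUnion.2 ⟨i, Finset.mem_univ i, ha⟩)

/-- Proposition 2.9: if `s x = var y` and `y` does not occur in `s x'` for `x' ≠ x`,
then `s⋆(∃x A) = ∃y (s⋆ A)` in `Hal_Θ(H)`. -/
theorem subst_exists_comm {L : Language} {H X Y : Type*} [L.Structure H] [DecidableEq Y]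
    (s : X → L.Term Y) (x : X) (y : Y)
    (hx : s x = Term.var y)
    (hy : ∀ x' ≠ x, y ∉ (s x').varFinset)
    (A : Set (X → H)) :
    (fun ν : Y → H => fun x' : X => (s x').realize ν) ⁻¹'
        {μ : X → H | ∃ ν ∈ A, ∀ x' ≠ x, μ x' = ν x'} =
    {μ : Y → H | ∃ ν ∈ ((fun ν : Y → H => fun x' : X => (s x').realize ν) ⁻¹' A),
        ∀ y' ≠ y, μ y' = ν y'} := by
  have realize_eq {μ ν : Y → H} (h : ∀ y' ≠ y, μ y' = ν y') (x' : X) (hx' : x' ≠ x) :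
      (s x').realize μ = (s x').realize ν :=
    Term.realize_congr_of_eqOn_varFinset fun a ha => h a fun hay => hy x' hx' (hay ▸ ha)
  ext μ
  constructor
  · rintro ⟨ν, hν, h⟩
    have hμ : ∀ y' ≠ y, μ y' = Function.update μ y (ν x) y' := fun y' hy' =>
      (Function.update_of_ne hy' _ _).symm
    refine ⟨Function.update μ y (ν x), ?_, hμ⟩
    have hs : (fun x' => (s x').realize (Function.update μ y (ν x))) = ν := by
      funext x'
      by_cases hx' : x' = x
      · subst hx'
        simp [hx]
      · exact (realize_eq hμ x' hx').symm.trans (h x' hx')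
    rwa [Set.mem_preimage, hs]
  · rintro ⟨ν, hν, h⟩
    exact ⟨_, hν, realize_eq h⟩
end

section
/- Nonempty L-structures H₁ and H₂ are LG-equivalent if and only if their disjunctive theories coincide, i.e. for every n and every T ⊆ L.Formula (Fin n): [every point μ : Fin n → H₁ satisfies at least one formula of T] holds if and only if [every point μ : Fin n → H₂ satisfies at least one formula of T]. (Proposition 3.6.) -/
open FirstOrder FirstOrder.Language

/-- The solution set `T^L_H` of a set of formulas `T`. -/
def solSet {L : Language} (H : Type*) [L.Structure H] {n : ℕ}
    (T : Set (L.Formula (Fin n))) : Set (Fin n → H) :=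
  {μ | ∀ φ ∈ T, φ.Realize μ}

/-- The set of formulas `A^L_H` valid on every point of `A`. -/
def thSet {L : Language} (H : Type*) [L.Structure H] {n : ℕ}
    (A : Set (Fin n → H)) : Set (L.Formula (Fin n)) :=
  {φ | ∀ μ ∈ A, φ.Realize μ}

/-- `H₁` and `H₂` are LG-equivalent if all double Galois closures agree. -/
def LGEquiv (L : Language) (H₁ H₂ : Type*) [L.Structure H₁] [L.Structure H₂] : Prop :=
  ∀ (n : ℕ) (T : Set (L.Formula (Fin n))),
    thSet (L := L) H₁ (solSet (L := L) H₁ T) = thSet (L := L) H₂ (solSet (L := L) H₂ T)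

/-- A disjunction of `T` holds everywhere iff falsum follows from the negations of `T`. -/
theorem bot_mem_thSet_solSet_not_iff {L : Language} (H : Type*) [L.Structure H] {n : ℕ}
    (T : Set (L.Formula (Fin n))) :
    (⊥ : L.Formula (Fin n)) ∈ thSet H (solSet H (Formula.not '' T)) ↔
      ∀ μ : Fin n → H, ∃ φ ∈ T, φ.Realize μ := by
  simp only [thSet, solSet, Set.mem_ofPred_eq, Set.forall_mem_image, Formula.realize_not,
    Formula.realize_bot]
  refine forall_congr' fun μ => ?_
  rw [imp_false]
  push Not
  rfl

/-- A formula follows from `T` iff the disjunction of it with the negations of `T` holds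
everywhere. -/
theorem mem_thSet_solSet_iff {L : Language} (H : Type*) [L.Structure H] {n : ℕ}
    (T : Set (L.Formula (Fin n))) (φ : L.Formula (Fin n)) :
    φ ∈ thSet H (solSet H T) ↔
      ∀ μ : Fin n → H, ∃ ψ ∈ insert φ (Formula.not '' T), ψ.Realize μ := by
  simp only [thSet, solSet, Set.mem_ofPred_eq, Set.exists_mem_insert, Set.exists_mem_image,
    Formula.realize_not]
  refine forall_congr' fun μ => ?_
  rw [imp_iff_or_not]
  push Not
  rfl

/-- Proposition 3.6: `H₁` and `H₂` are LG-equivalent iff their disjunctive theories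
coincide. -/
theorem lgEquiv_iff_disjunctive_theories {L : Language} {H₁ H₂ : Type*}
    [L.Structure H₁] [L.Structure H₂] [Nonempty H₁] [Nonempty H₂] :
    LGEquiv L H₁ H₂ ↔
      ∀ (n : ℕ) (T : Set (L.Formula (Fin n))),
        ((∀ μ : Fin n → H₁, ∃ φ ∈ T, φ.Realize μ) ↔
         (∀ μ : Fin n → H₂, ∃ φ ∈ T, φ.Realize μ)) := by
  refine ⟨fun h n T => ?_, fun h n T => ?_⟩
  · rw [← bot_mem_thSet_solSet_not_iff, ← bot_mem_thSet_solSet_not_iff, h]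
  · ext φ
    rw [mem_thSet_solSet_iff, mem_thSet_solSet_iff, h]
end

section
/- If nonempty L-structures H₁ and H₂ are LG-equivalent, then they are elementarily equivalent: for every sentence φ : L.Sentence, H₁ ⊨ φ if and only if H₂ ⊨ φ. (Proposition 3.7.) -/
open FirstOrder FirstOrder.Language

theorem relabel_mem_thSet_solSet_empty {L : Language} (H : Type*) [L.Structure H]
    (φ : L.Sentence) :
    (φ.relabel Empty.elim : L.Formula (Fin 0)) ∈ thSet H (solSet (L := L) H ∅) ↔ H ⊨ φ := by
  have key (μ : Fin 0 → H) :
      (φ.relabel Empty.elim : L.Formula (Fin 0)).Realize μ ↔ H ⊨ φ := by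
    rw [Formula.realize_relabel, Sentence.Realize, Subsingleton.elim (μ ∘ Empty.elim) default]
  simp [thSet, solSet, key]

/-- Proposition 3.7: LG-equivalent structures are elementarily equivalent. -/
theorem lgEquiv_elementarilyEquivalent {L : Language} {H₁ H₂ : Type*}
    [L.Structure H₁] [L.Structure H₂] [Nonempty H₁] [Nonempty H₂]
    (h : LGEquiv L H₁ H₂) (φ : L.Sentence) :
    H₁ ⊨ φ ↔ H₂ ⊨ φ := by
  rw [← relabel_mem_thSet_solSet_empty H₁, h, relabel_mem_thSet_solSet_empty]
end

section
/- Nonempty L-structures H₁ and H₂ are LG-equivalent if and only if they are LG-isotypic. (Theorem 3.9, the main theorem relating logical equivalence and isotypeness.) -/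
open FirstOrder FirstOrder.Language

/-- The logical kernel of a point `μ : Fin n → H`. -/
def LKer {L : Language} {H : Type*} [L.Structure H] {n : ℕ} (μ : Fin n → H) :
    Set (L.Formula (Fin n)) :=
  {φ | φ.Realize μ}

/-- `H₁` and `H₂` are LG-isotypic if every point of one realizes the logical kernel of a
point of the other. -/
def LGIsotypic (L : Language) (H₁ H₂ : Type*) [L.Structure H₁] [L.Structure H₂] : Prop :=
  ∀ n : ℕ,
    (∀ μ : Fin n → H₁, ∃ ν : Fin n → H₂, LKer (L := L) μ = LKer (L := L) ν) ∧
    (∀ ν : Fin n → H₂, ∃ μ : Fin n → H₁, LKer (L := L) ν = LKer (L := L) μ)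

theorem LKer_eq_of_subset {L : Language} {H₁ H₂ : Type*} [L.Structure H₁] [L.Structure H₂]
    {n : ℕ} {μ : Fin n → H₁} {ν : Fin n → H₂} (h : LKer (L := L) μ ⊆ LKer (L := L) ν) :
    LKer (L := L) μ = LKer (L := L) ν := by
  refine h.antisymm fun φ hφ => ?_
  by_contra hn
  have h_not : φ.not ∈ LKer (L := L) μ := Formula.realize_not.mpr hn
  exact Formula.realize_not.mp (h h_not) hφ

theorem LGEquiv.symm {L : Language} {H₁ H₂ : Type*} [L.Structure H₁] [L.Structure H₂]
    (h : LGEquiv L H₁ H₂) : LGEquiv L H₂ H₁ :=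
  fun n T => (h n T).symm

theorem LGEquiv.exists_LKer_eq {L : Language} {H₁ H₂ : Type*} [L.Structure H₁]
    [L.Structure H₂] (h : LGEquiv L H₁ H₂) {n : ℕ} (μ : Fin n → H₁) :
    ∃ ν : Fin n → H₂, LKer (L := L) μ = LKer (L := L) ν := by
  by_contra! hn
  have h_bot : (⊥ : L.Formula (Fin n)) ∈ thSet H₂ (solSet H₂ (LKer (L := L) μ)) :=
    fun ν hν => (hn ν (LKer_eq_of_subset hν)).elim
  rw [← h n] at h_bot
  exact h_bot μ fun _ hφ => hφ

theorem thSet_solSet_subset {L : Language} {H₁ H₂ : Type*} [L.Structure H₁] [L.Structure H₂]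
    {n : ℕ} (h : ∀ ν : Fin n → H₂, ∃ μ : Fin n → H₁, LKer (L := L) ν = LKer (L := L) μ)
    (T : Set (L.Formula (Fin n))) :
    thSet (L := L) H₁ (solSet H₁ T) ⊆ thSet H₂ (solSet H₂ T) := by
  intro φ hφ ν hν
  obtain ⟨μ, hμ⟩ := h ν
  have hT : T ⊆ LKer (L := L) ν := hν
  have h_mem : φ ∈ LKer (L := L) μ := hφ μ (hT.trans hμ.subset)
  rwa [← hμ] at h_mem

/-- Theorem 3.9: `H₁` and `H₂` are LG-equivalent iff they are LG-isotypic. -/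
theorem lgEquiv_iff_lgIsotypic {L : Language} {H₁ H₂ : Type*}
    [L.Structure H₁] [L.Structure H₂] [Nonempty H₁] [Nonempty H₂] :
    LGEquiv L H₁ H₂ ↔ LGIsotypic L H₁ H₂ := by
  exact ⟨fun h _ => ⟨h.exists_LKer_eq, h.symm.exists_LKer_eq⟩, fun h n T =>
    (thSet_solSet_subset (h n).2 T).antisymm (thSet_solSet_subset (h n).1 T)⟩
end

section
/- If nonempty L-structures H₁ and H₂ are LG-isotypic, then they are elementarily equivalent: for every sentence φ : L.Sentence, H₁ ⊨ φ if and only if H₂ ⊨ φ. (Corollary 3.10.) -/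
open FirstOrder FirstOrder.Language

/-- A sentence is realized in `H` exactly when its relabelling to `n` variables belongs to the
logical kernel of any point of arity `n`. -/
theorem relabel_mem_LKer_iff {L : Language} {H : Type*} [L.Structure H] {n : ℕ}
    (μ : Fin n → H) (φ : L.Sentence) :
    Formula.relabel (Empty.elim : Empty → Fin n) φ ∈ LKer (L := L) μ ↔ H ⊨ φ := by
  change (Formula.relabel _ φ).Realize μ ↔ _
  rw [Formula.realize_relabel, Sentence.Realize, Subsingleton.elim (μ ∘ Empty.elim) default]

/-- Corollary 3.10: LG-isotypic structures are elementarily equivalent. -/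
theorem lgIsotypic_elementarilyEquivalent {L : Language} {H₁ H₂ : Type*}
    [L.Structure H₁] [L.Structure H₂] [Nonempty H₁] [Nonempty H₂]
    (h : LGIsotypic L H₁ H₂) (φ : L.Sentence) :
    H₁ ⊨ φ ↔ H₂ ⊨ φ := by
  obtain ⟨ν, hν⟩ := (h 0).1 Fin.elim0
  rw [← relabel_mem_LKer_iff Fin.elim0 φ, hν, relabel_mem_LKer_iff]
end

section
/- If a nonempty L-structure H is logically noetherian, then H is LG-saturated: for every n, every complete n-type p over H equals LKer(μ) for some point μ : Fin n → H. (Theorem 3.33.) -/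
open FirstOrder FirstOrder.Language

/-- A complete `n`-type over `H`: a Boolean ultrafilter in the Lindenbaum–Tarski algebra
containing the elementary theory of `H`, i.e. a set of formulas which decides every
formula and all of whose finite subsets are realized in `H`. -/
def CompleteNType {L : Language} (H : Type*) [L.Structure H] {n : ℕ}
    (p : Set (L.Formula (Fin n))) : Prop :=
  (∀ φ : L.Formula (Fin n), φ ∈ p ↔ φ.not ∉ p) ∧
  (∀ S : Finset (L.Formula (Fin n)), ↑S ⊆ p → ∃ μ : Fin n → H, ∀ φ ∈ S, φ.Realize μ)

/-- `H` is logically noetherian: every system of equations-formulas is equivalent to a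
finite subsystem. -/
def LogicallyNoetherian (L : Language) (H : Type*) [L.Structure H] : Prop :=
  ∀ (n : ℕ) (T : Set (L.Formula (Fin n))),
    ∃ T₀ : Finset (L.Formula (Fin n)), ↑T₀ ⊆ T ∧
      solSet (L := L) H (↑T₀ : Set (L.Formula (Fin n))) = solSet (L := L) H T

/-- Theorem 3.33: a logically noetherian algebra is LG-saturated. -/
theorem logicallyNoetherian_lgSaturated {L : Language} {H : Type*} [L.Structure H]
    [Nonempty H] (h : LogicallyNoetherian L H) :
    ∀ (n : ℕ) (p : Set (L.Formula (Fin n))), CompleteNType H p →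
      ∃ μ : Fin n → H, p = LKer μ := by
  intro n p ⟨hp, hfin⟩
  obtain ⟨T₀, hT₀, hsol⟩ := h n p
  obtain ⟨μ, hμ⟩ := hfin T₀ hT₀
  have hμp : ∀ φ ∈ p, φ.Realize μ := by
    have hmem : μ ∈ solSet (L := L) H (↑T₀ : Set (L.Formula (Fin n))) := hμ
    rw [hsol] at hmem
    exact hmem
  refine ⟨μ, Set.Subset.antisymm hμp fun φ hφ => ?_⟩
  rw [hp φ]
  exact fun hn => Formula.realize_not.mp (hμp _ hn) hφ
end

section
/- If a nonempty L-structure H is LG-saturated, then H is MT-saturated: for every n and every set T of n-special formulas such that every finite subset of T is simultaneously realized by some η : ℕ → H, there exists a point μ : Fin n → H with T ⊆ Tp^H(μ). (Theorem 4.5.) -/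
open FirstOrder FirstOrder.Language

/-- The MT-type of a point `μ : Fin n → H`: the set of `n`-special formulas valid on
every extension of `μ` to the infinite set of variables. -/
def MTType {L : Language} (H : Type*) [L.Structure H] {n : ℕ} (μ : Fin n → H) :
    Set (L.Formula ℕ) :=
  {φ | φ.freeVarFinset ⊆ Finset.range n ∧
    ∀ η : ℕ → H, (∀ i : Fin n, η i.val = μ i) → φ.Realize η}

/-- `H` is LG-saturated: every complete `n`-type is the logical kernel of a point. -/
def LGSaturated (L : Language) (H : Type*) [L.Structure H] : Prop :=
  ∀ (n : ℕ) (p : Set (L.Formula (Fin n))), CompleteNType H p →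
    ∃ μ : Fin n → H, p = LKer μ

/-- A formula in the variables `ℕ` whose free variables lie below `n` is equivalent to a formula
in the variables `Fin n`. -/
theorem FirstOrder.Language.Formula.exists_realize_fin_iff {L : Language} {n : ℕ}
    (φ : L.Formula ℕ) (hφ : φ.freeVarFinset ⊆ Finset.range n) :
    ∃ ψ : L.Formula (Fin n), ∀ {H : Type*} [L.Structure H] (η : ℕ → H),
      ψ.Realize (fun i : Fin n => η i) ↔ φ.Realize η :=
  ⟨BoundedFormula.restrictFreeVar φ fun a => ⟨a, Finset.mem_range.1 (hφ a.2)⟩,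
    fun η => BoundedFormula.realize_restrictFreeVar η fun _ => rfl⟩

/-- The formulas holding at almost every point of a family, with respect to an ultrafilter on the
index set, form a complete type. -/
theorem completeNType_ultrafilter {L : Language} {H ι : Type*} [L.Structure H] {n : ℕ}
    (U : Ultrafilter ι) (μ : ι → Fin n → H) :
    CompleteNType H {φ : L.Formula (Fin n) | ∀ᶠ i in U, φ.Realize (μ i)} := by
  refine ⟨fun φ => ?_, fun S hS => ?_⟩
  · simp only [Set.mem_ofPred_eq, Formula.realize_not, Ultrafilter.eventually_not, not_not]
  · obtain ⟨i, hi⟩ := ((Filter.eventually_all_finset S).2 fun φ hφ => hS hφ).exists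
    exact ⟨μ i, hi⟩

/-- Theorem 4.5: an LG-saturated algebra is MT-saturated. -/
theorem lgSaturated_mtSaturated {L : Language} {H : Type*} [L.Structure H] [Nonempty H]
    (h : LGSaturated L H) :
    ∀ (n : ℕ) (T : Set (L.Formula ℕ)),
      (∀ φ ∈ T, φ.freeVarFinset ⊆ Finset.range n) →
      (∀ S : Finset (L.Formula ℕ), ↑S ⊆ T → ∃ η : ℕ → H, ∀ φ ∈ S, φ.Realize η) →
      ∃ μ : Fin n → H, T ⊆ MTType H μ := by
  intro n T hT hfin
  obtain ⟨U, hU⟩ := Ultrafilter.exists_ultrafilter_of_finite_inter_nonempty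
    ((fun φ : L.Formula ℕ => {η : ℕ → H | φ.Realize η}) '' T) (by
      classical
      intro S hS
      obtain ⟨S', hS', rfl⟩ := Finset.subset_set_image_iff.1 hS
      obtain ⟨η, hη⟩ := hfin S' hS'
      exact ⟨η, by simpa using hη⟩)
  obtain ⟨μ, hμ⟩ := h n _ (completeNType_ultrafilter U fun η i => η i)
  refine ⟨μ, fun φ hφ => ⟨hT φ hφ, fun η hη => ?_⟩⟩
  obtain ⟨ψ, hψ⟩ := φ.exists_realize_fin_iff (hT φ hφ)
  have hmem : ψ ∈ LKer μ := by
    rw [← hμ]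
    exact Filter.mem_of_superset (hU ⟨φ, hφ, rfl⟩) fun η hη => (hψ η).2 hη
  rw [← hψ η, funext hη]
  exact hmem
end

section
/- Let H₁ and H₂ be nonempty L-structures and μ : Fin n → H₁, ν : Fin n → H₂ points with LKer(μ) = LKer(ν). Then there exists an L-isomorphism σ between the substructure of H₁ generated by the range of μ and the substructure of H₂ generated by the range of ν such that σ maps μ i to ν i for every i : Fin n. (This is the key lemma established inside the proof of Theorem 3.30: points with equal logical kernels generate isomorphic subalgebras via aᵢ ↦ bᵢ.) -/
open FirstOrder FirstOrder.Language

namespace FirstOrder.Language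

variable {L : Language} {M N : Type*} [L.Structure M] [L.Structure N] {α : Type*}

theorem Substructure.realize_mem_closure_range (v : α → M) (t : L.Term α) :
    t.realize v ∈ closure L (Set.range v) :=
  t.realize_mem v fun a => subset_closure (Set.mem_range_self a)

theorem Substructure.exists_realize_eq_of_mem_closure_range {v : α → M} {x : M}
    (hx : x ∈ closure L (Set.range v)) : ∃ t : L.Term α, t.realize v = x := by
  obtain ⟨t, rfl⟩ := mem_closure_iff_exists_term.1 hx
  refine ⟨t.relabel fun y => y.2.choose, ?_⟩
  rw [Term.realize_relabel]
  congr 1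
  funext y
  exact y.2.choose_spec

/-- A term over `α` representing an element of the substructure generated by `v : α → M`. -/
noncomputable def Substructure.closureRangeTerm (v : α → M)
    (x : closure L (Set.range v)) : L.Term α :=
  (exists_realize_eq_of_mem_closure_range x.2).choose

theorem Substructure.realize_closureRangeTerm (v : α → M) (x : closure L (Set.range v)) :
    (closureRangeTerm v x).realize v = x :=
  (exists_realize_eq_of_mem_closure_range x.2).choose_spec

open Substructure in
/-- Tuples satisfying the same equalities and relations between terms generate isomorphic
substructures. -/
noncomputable def closureRangeEquiv (v : α → M) (w : α → N)
    (h_eq : ∀ s t : L.Term α, s.realize v = t.realize v ↔ s.realize w = t.realize w)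
    (h_rel : ∀ {k : ℕ} (R : L.Relations k) (ts : Fin k → L.Term α),
      (Structure.RelMap R fun i => (ts i).realize v) ↔
        Structure.RelMap R fun i => (ts i).realize w) :
    closure L (Set.range v) ≃[L] closure L (Set.range w) where
  toFun x := ⟨(closureRangeTerm v x).realize w, realize_mem_closure_range w _⟩
  invFun y := ⟨(closureRangeTerm w y).realize v, realize_mem_closure_range v _⟩
  left_inv x := Subtype.ext <| by
    rw [← realize_closureRangeTerm v x, h_eq, realize_closureRangeTerm]
  right_inv y := Subtype.ext <| by
    rw [← realize_closureRangeTerm w y, ← h_eq, realize_closureRangeTerm]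
  map_fun' f x := Subtype.ext <| by
    refine (h_eq _ (Term.func f fun i => closureRangeTerm v (x i))).1 ?_
    simp only [realize_closureRangeTerm, Term.realize_func]
    rfl
  map_rel' R x := by
    refine (h_rel R fun i => closureRangeTerm v (x i)).symm.trans ?_
    simp only [realize_closureRangeTerm]
    rfl

theorem closureRangeEquiv_realize (v : α → M) (w : α → N)
    (h_eq : ∀ s t : L.Term α, s.realize v = t.realize v ↔ s.realize w = t.realize w)
    (h_rel : ∀ {k : ℕ} (R : L.Relations k) (ts : Fin k → L.Term α),
      (Structure.RelMap R fun i => (ts i).realize v) ↔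
        Structure.RelMap R fun i => (ts i).realize w) (t : L.Term α) :
    (closureRangeEquiv v w h_eq h_rel
      ⟨t.realize v, Substructure.realize_mem_closure_range v t⟩ : N) = t.realize w :=
  (h_eq _ t).1 (Substructure.realize_closureRangeTerm v _)

end FirstOrder.Language

/-- The key lemma from the proof of Theorem 3.30: points with equal logical kernels
generate isomorphic subalgebras via `μ i ↦ ν i`. -/
theorem exists_iso_of_lker_eq {L : Language} {H₁ H₂ : Type*}
    [L.Structure H₁] [L.Structure H₂] [Nonempty H₁] [Nonempty H₂] {n : ℕ}
    (μ : Fin n → H₁) (ν : Fin n → H₂)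
    (h : LKer (L := L) μ = LKer (L := L) ν) :
    ∃ σ : (Substructure.closure L (Set.range μ)) ≃[L] (Substructure.closure L (Set.range ν)),
      ∀ i : Fin n,
        (σ ⟨μ i, Substructure.subset_closure (Set.mem_range_self i)⟩ : H₂) = ν i := by
  have h_iff (φ : L.Formula (Fin n)) : φ.Realize μ ↔ φ.Realize ν := Set.ext_iff.1 h φ
  exact ⟨closureRangeEquiv μ ν (fun s t => by simpa using h_iff (s.equal t))
    (fun R ts => by simpa using h_iff (R.formula ts)),
    fun i => closureRangeEquiv_realize μ ν _ _ (Term.var i)⟩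
end

section
/- Every finite nonempty L-structure H is logically noetherian: for every n and every set T ⊆ L.Formula (Fin n), there exists a finite subset T₀ ⊆ T whose solution set over H equals that of T, i.e. T₀^L_H = T^L_H. (Claim of Section 3.7: each finite algebra is logically noetherian.) -/
open FirstOrder FirstOrder.Language

/-- Section 3.7: every finite algebra is logically noetherian. -/
theorem finite_logicallyNoetherian {L : Language} {H : Type*} [L.Structure H]
    [Nonempty H] [Finite H] (n : ℕ) (T : Set (L.Formula (Fin n))) :
    ∃ T₀ : Finset (L.Formula (Fin n)), ↑T₀ ⊆ T ∧
      solSet (L := L) H (↑T₀ : Set (L.Formula (Fin n))) = solSet (L := L) H T := by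
  classical
  have : Fintype ↥(solSet (L := L) H T)ᶜ := Fintype.ofFinite _
  have hφ : ∀ μ : ↥(solSet (L := L) H T)ᶜ, ∃ φ ∈ T, ¬ φ.Realize μ.1 := by
    rintro ⟨μ, hμ⟩
    simpa [solSet] using hμ
  choose φ hφT hφ using hφ
  have hsub : (↑(Finset.univ.image φ) : Set (L.Formula (Fin n))) ⊆ T := by
    simpa [Set.range_subset_iff] using fun μ hμ => hφT ⟨μ, hμ⟩
  refine ⟨Finset.univ.image φ, hsub, Set.Subset.antisymm (fun μ hμ => ?_)
    fun μ hμ ψ hψ => hμ ψ (hsub hψ)⟩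
  by_contra h
  exact hφ ⟨μ, h⟩ (hμ _ (Finset.mem_coe.2 (Finset.mem_image_of_mem φ (Finset.mem_univ _))))
end

section
/- Let H be a nonempty L-structure and n a natural number such that the action of the group of L-automorphisms of H on points (Fin n → H), given by σ · μ = σ ∘ μ, has only finitely many orbits. Then for every T ⊆ L.Formula (Fin n) there exists a finite subset T₀ ⊆ T with T₀^L_H = T^L_H. (Claim of Section 3.8: an automorphically finitary algebra is logically noetherian.) -/
open FirstOrder FirstOrder.Language

theorem comp_mem_solSet_iff {L : Language} {H : Type*} [L.Structure H] {n : ℕ}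
    (T : Set (L.Formula (Fin n))) (σ : H ≃[L] H) (μ : Fin n → H) :
    ⇑σ ∘ μ ∈ solSet H T ↔ μ ∈ solSet H T :=
  forall₂_congr fun φ _ => StrongHomClass.realize_formula σ φ

/-- A single point is cut out of the solution set of `T` by finitely many formulas of `T`. -/
theorem exists_finset_mem_solSet_imp {L : Language} {H : Type*} [L.Structure H] {n : ℕ}
    (T : Set (L.Formula (Fin n))) (μ : Fin n → H) :
    ∃ F : Finset (L.Formula (Fin n)), ↑F ⊆ T ∧
      (μ ∈ solSet H (↑F : Set (L.Formula (Fin n))) → μ ∈ solSet H T) := by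
  by_cases h : μ ∈ solSet H T
  · exact ⟨∅, by simp, fun _ => h⟩
  · obtain ⟨φ, hφ, hμ⟩ : ∃ φ ∈ T, ¬ φ.Realize μ := by
      simpa [solSet] using h
    exact ⟨{φ}, by simpa using hφ, fun hF => absurd (hF φ (by simp)) hμ⟩

/-- Section 3.8: if the action of `Aut(H)` on points of arity `n` has only finitely many
orbits, then every system of formulas in that arity is equivalent to a finite
subsystem. -/
theorem automorphicallyFinitary_logicallyNoetherian {L : Language} {H : Type*}
    [L.Structure H] [Nonempty H] (n : ℕ)
    (hfin : {A : Set (Fin n → H) | ∃ μ : Fin n → H,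
        A = {ν | ∃ σ : H ≃[L] H, ν = ⇑σ ∘ μ}}.Finite)
    (T : Set (L.Formula (Fin n))) :
    ∃ T₀ : Finset (L.Formula (Fin n)), ↑T₀ ⊆ T ∧
      solSet (L := L) H (↑T₀ : Set (L.Formula (Fin n))) = solSet (L := L) H T := by
  classical
  have orbit_finset : ∀ A ∈ hfin.toFinset, ∃ F : Finset (L.Formula (Fin n)), ↑F ⊆ T ∧
      ∀ ν ∈ A, ν ∈ solSet H (↑F : Set (L.Formula (Fin n))) → ν ∈ solSet H T := by
    intro A hA
    obtain ⟨μ, rfl⟩ := hfin.mem_toFinset.1 hA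
    obtain ⟨F, hFT, hF⟩ := exists_finset_mem_solSet_imp T μ
    refine ⟨F, hFT, ?_⟩
    rintro _ ⟨σ, rfl⟩ hσ
    rw [comp_mem_solSet_iff] at hσ ⊢
    exact hF hσ
  choose F hFT hF using orbit_finset
  have hsub : ↑(hfin.toFinset.attach.biUnion fun A => F A.1 A.2) ⊆ T := by
    intro φ hφ
    obtain ⟨A, -, hφA⟩ := Finset.mem_biUnion.1 (Finset.mem_coe.1 hφ)
    exact hFT A.1 A.2 hφA
  refine ⟨_, hsub, Set.Subset.antisymm (fun μ hμ => ?_) fun μ hμ φ hφ => hμ φ (hsub hφ)⟩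
  have hA : {ν | ∃ σ : H ≃[L] H, ν = ⇑σ ∘ μ} ∈ hfin.toFinset := hfin.mem_toFinset.2 ⟨μ, rfl⟩
  exact hF _ hA μ ⟨FirstOrder.Language.Equiv.refl L H, rfl⟩ fun φ hφ =>
    hμ φ (Finset.mem_coe.2 (Finset.mem_biUnion.2 ⟨⟨_, hA⟩, Finset.mem_attach _ _, hφ⟩))
end

section
/- Let H be a nonempty L-structure that is logically homogeneous at arity n: for all points μ, ν : Fin n → H, LKer(μ) = LKer(ν) if and only if there exists an L-automorphism σ : H ≃[L] H with μ = σ ∘ ν. Then for every point μ : Fin n → H, the solution set of its logical kernel equals its automorphism orbit: (LKer(μ))^L_H = {ν : Fin n → H | ∃ σ : H ≃[L] H, ν = σ ∘ μ}. (Claim of Section 4.5: for a logically homogeneous algebra, each Aut(H)-orbit is the definable set determined by the logical kernel of any of its points.) -/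
open FirstOrder FirstOrder.Language

/-- Section 4.5: if `H` is logically homogeneous at arity `n`, then the definable set
determined by the logical kernel of a point is exactly its `Aut(H)`-orbit. -/
theorem orbit_eq_solSet_lker {L : Language} {H : Type*} [L.Structure H] [Nonempty H]
    {n : ℕ}
    (hhom : ∀ μ ν : Fin n → H,
      LKer (L := L) μ = LKer (L := L) ν ↔ ∃ σ : H ≃[L] H, μ = ⇑σ ∘ ν)
    (μ : Fin n → H) :
    solSet (L := L) H (LKer (L := L) μ) = {ν | ∃ σ : H ≃[L] H, ν = ⇑σ ∘ μ} := by
  ext ν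
  rw [Set.mem_ofPred_eq, ← hhom]
  refine ⟨fun h => Set.Subset.antisymm (fun φ hφ => ?_) fun φ hφ => h φ hφ, fun h φ hφ => ?_⟩
  · by_contra hn
    exact Formula.realize_not.1 (h φ.not (Formula.realize_not.2 hn)) hφ
  · exact h.symm.subset hφ
end
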